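/- arXiv:1404.0358 — 2 statements merged into one kernel-verified Lean document; each statement's English description precedes it below -/
import Mathlib

section
/- Let A be a real symmetric 2×2 matrix and let e ∈ ℝ² be a unit vector. Then ‖A‖² − |Ae|² ≥ (1/2)·‖A‖² − ‖A‖·|tr A|, where ‖A‖ denotes the Frobenius norm of A (so ‖A‖² is the sum of the squares of the entries of A), |Ae| is the Euclidean norm of the vector Ae, and tr A is the trace of A. -/
/-- Schoen–Simon type pointwise inequality in dimension 2: for a real symmetric 2×2
matrix `A` and a unit vector `e`,
`‖A‖² − |Ae|² ≥ (1/2)‖A‖² − ‖A‖·|tr A|`, where `‖A‖` is the Frobenius norm. -/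
theorem frobenius_sub_vec_sq_ge
    (A : Matrix (Fin 2) (Fin 2) ℝ) (hA : A.IsSymm)
    (e : Fin 2 → ℝ) (he : ∑ i, (e i) ^ 2 = 1) :
    (∑ i, ∑ j, (A i j) ^ 2) - ∑ i, (∑ j, A i j * e j) ^ 2 ≥
      (1 / 2) * (∑ i, ∑ j, (A i j) ^ 2) -
        Real.sqrt (∑ i, ∑ j, (A i j) ^ 2) * |A.trace| := by
  have hsymm : A 1 0 = A 0 1 := hA.apply 0 1
  simp only [Fin.sum_univ_two, Matrix.trace_fin_two, hsymm] at he ⊢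
  generalize A 0 0 = a, A 0 1 = b, A 1 1 = d, e 0 = x, e 1 = y at *
  -- `q` is the quadratic form of the trace-free part of `A` at `e`
  set q := (a - d) / 2 * (x ^ 2 - y ^ 2) + 2 * b * x * y
  have hq_sq : q ^ 2 ≤ a ^ 2 + b ^ 2 + (b ^ 2 + d ^ 2) := by
    have h : q ^ 2 + ((a - d) * x * y - b * (x ^ 2 - y ^ 2)) ^ 2 = (a - d) ^ 2 / 4 + b ^ 2 := by
      linear_combination ((a - d) ^ 2 / 4 + b ^ 2) * (x ^ 2 + y ^ 2 + 1) * he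
    nlinarith [sq_nonneg ((a - d) * x * y - b * (x ^ 2 - y ^ 2)), sq_nonneg (a + d),
      sq_nonneg a, sq_nonneg d, sq_nonneg b]
  have hq_mul : (a * x + b * y) ^ 2 + (b * x + d * y) ^ 2
      - 1 / 2 * (a ^ 2 + b ^ 2 + (b ^ 2 + d ^ 2)) = q * (a + d) := by
    linear_combination (a ^ 2 + 2 * b ^ 2 + d ^ 2) / 2 * he
  have hle : q * (a + d) ≤ √(a ^ 2 + b ^ 2 + (b ^ 2 + d ^ 2)) * |a + d| :=
    (le_abs_self _).trans <| by
      rw [abs_mul]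
      exact mul_le_mul_of_nonneg_right (Real.abs_le_sqrt hq_sq) (abs_nonneg _)
  linarith
end

section
/- Let A = (a_{ij}) be a real symmetric 2×2 matrix, with all indices ranging over {1,2}. Then Σ_{i,j,k,m} a_{ij}(a_{ki}a_{jm} − a_{ji}a_{km})a_{mk} + Σ_{i,j,k,m} a_{ij}(a_{kk}a_{jm} − a_{jk}a_{km})a_{mi} ≥ −2·(Σ_{i,j} a_{ij}²)². -/
open Finset in
/-- Quartic-term estimate in the Simons-type inequality: for a real symmetric 2×2
array `a`, the two quartic curvature sums are bounded below by `−2(Σ a_{ij}²)²`. -/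
theorem simons_quartic_term_estimate
    (a : Fin 2 → Fin 2 → ℝ) (hsymm : ∀ i j, a i j = a j i) :
    (∑ i, ∑ j, ∑ k, ∑ m, a i j * (a k i * a j m - a j i * a k m) * a m k) +
      (∑ i, ∑ j, ∑ k, ∑ m, a i j * (a k k * a j m - a j k * a k m) * a m i) ≥
      -2 * (∑ i, ∑ j, (a i j) ^ 2) ^ 2 := by
  simp only [Fin.sum_univ_two, hsymm 1 0]
  generalize a 0 0 = x, a 0 1 = y, a 1 1 = z
  -- The left side equals `tr A * tr A³ - |A|⁴`, and `tr A³ = tr A * (|A|² - det A)`.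
  have trace_mul_trace_cube_nonneg : 0 ≤ (x + z) ^ 2 * (x ^ 2 - x * z + z ^ 2 + 3 * y ^ 2) :=
    mul_nonneg (sq_nonneg _) (by nlinarith [sq_nonneg (x - z), sq_nonneg x, sq_nonneg z])
  linarith [sq_nonneg (x ^ 2 + 2 * y ^ 2 + z ^ 2)]
end
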